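/- For μ, ν ∈ M the following are equivalent: (i) μ ≤_{sto,+} ν, i.e. ∫φ dμ ≤ ∫φ dν for every non-negative non-decreasing φ of at most linear growth; (ii) there exists η ∈ M with μ ≤_sto η and η ≤_+ ν. Moreover, when μ(ℝ) ≤ ν(ℝ), the rightmost measure η = (G_ν)_#(λ|_{(ν(ℝ)−μ(ℝ), ν(ℝ)]}) (pushforward of Lebesgue measure restricted to the top interval of quantile levels by the quantile function of ν) serves as such an intermediate measure. -/

import Mathlib

open MeasureTheory Set Filter ProbabilityTheory

noncomputable section

/-- A function has at most linear growth. -/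
def LinGrowth (φ : ℝ → ℝ) : Prop := ∃ C : ℝ, ∀ x : ℝ, |φ x| ≤ C * (1 + |x|)

/-- Membership in `M`: finite positive Borel measure on `ℝ` with finite first moment. -/
def MemM (μ : Measure ℝ) : Prop := IsFiniteMeasure μ ∧ Integrable (fun x => x) μ

/-- Stochastic order `≤_sto`. -/
def leSto (μ ν : Measure ℝ) : Prop :=
  ∀ φ : ℝ → ℝ, LinGrowth φ → Monotone φ → ∫ x, φ x ∂μ ≤ ∫ x, φ x ∂ν

/-- Convex order `≤_C`. -/
def leC (μ ν : Measure ℝ) : Prop :=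
  ∀ φ : ℝ → ℝ, LinGrowth φ → ConvexOn ℝ Set.univ φ → ∫ x, φ x ∂μ ≤ ∫ x, φ x ∂ν

/-- Order `≤_{C,+}` (extended order). -/
def leCP (μ ν : Measure ℝ) : Prop :=
  ∀ φ : ℝ → ℝ, LinGrowth φ → ConvexOn ℝ Set.univ φ → (∀ x, 0 ≤ φ x) →
    ∫ x, φ x ∂μ ≤ ∫ x, φ x ∂ν

/-- Order `≤_{sto,+}`. -/
def leStoP (μ ν : Measure ℝ) : Prop :=
  ∀ φ : ℝ → ℝ, LinGrowth φ → Monotone φ → (∀ x, 0 ≤ φ x) →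
    ∫ x, φ x ∂μ ≤ ∫ x, φ x ∂ν

/-- Order `≤_{C,sto}`. -/
def leCS (μ ν : Measure ℝ) : Prop :=
  ∀ φ : ℝ → ℝ, LinGrowth φ → ConvexOn ℝ Set.univ φ → Monotone φ →
    ∫ x, φ x ∂μ ≤ ∫ x, φ x ∂ν

/-- Order `≤_{C,+,sto}`. -/
def leCPS (μ ν : Measure ℝ) : Prop :=
  ∀ φ : ℝ → ℝ, LinGrowth φ → ConvexOn ℝ Set.univ φ → (∀ x, 0 ≤ φ x) → Monotone φ →
    ∫ x, φ x ∂μ ≤ ∫ x, φ x ∂ν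

/-- The Kantorovich distance. -/
def W (μ ν : Measure ℝ) : ℝ :=
  sSup {d : ℝ | ∃ f : ℝ → ℝ, LipschitzWith 1 f ∧ d = |∫ x, f x ∂μ - ∫ x, f x ∂ν|}

/-- Quantile function `G_ν`. -/
def quantile (ν : Measure ℝ) (t : ℝ) : ℝ := sInf {x : ℝ | t ≤ (ν (Set.Iic x)).toReal}

/-- `IsShadow μ ν η` means `η = S^ν(μ)`, the shadow of `μ` in `ν`. -/
def IsShadow (μ ν η : Measure ℝ) : Prop :=
  leC μ η ∧ η ≤ ν ∧ ∀ η' : Measure ℝ, leC μ η' → η' ≤ ν → leC η η'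

/-- `Top(μ,ν)`: pushforward of Lebesgue measure on `(0, m]` by `max (G_μ) (G_ν)`. -/
def TopMeas (μ ν : Measure ℝ) : Measure ℝ :=
  Measure.map (fun t => max (quantile μ t) (quantile ν t))
    (volume.restrict (Set.Ioc (0:ℝ) (μ Set.univ).toReal))

/-- `Down(μ,ν)`: pushforward of Lebesgue measure on `(0, m]` by `min (G_μ) (G_ν)`. -/
def DownMeas (μ ν : Measure ℝ) : Measure ℝ :=
  Measure.map (fun t => min (quantile μ t) (quantile ν t))
    (volume.restrict (Set.Ioc (0:ℝ) (μ Set.univ).toReal))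

/-- Support of a measure on a topological space. -/
def mSupport {α : Type*} [TopologicalSpace α] [MeasurableSpace α] (μ : Measure α) : Set α :=
  {x | ∀ U ∈ nhds x, μ U ≠ 0}

/-- Positive part (Jordan decomposition) of the signed measure `η - μ`. -/
def posPartSub (η μ : Measure ℝ) [IsFiniteMeasure η] [IsFiniteMeasure μ] : Measure ℝ :=
  (η.toSignedMeasure - μ.toSignedMeasure).toJordanDecomposition.posPart

/-- `π` is a martingale coupling of `μ` and `ν`. -/
def IsMartCoupling (π : Measure (ℝ × ℝ)) (μ ν : Measure ℝ) : Prop :=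
  IsProbabilityMeasure π ∧ π.fst = μ ∧ π.snd = ν ∧
    ∀ f : ℝ → ℝ, Continuous f → (∃ C : ℝ, ∀ x, |f x| ≤ C) →
      ∫ p : ℝ × ℝ, f p.1 * (p.2 - p.1) ∂π = 0

/-- A coupling is left-monotone. -/
def LeftMonotone (π : Measure (ℝ × ℝ)) : Prop :=
  ∃ Γ : Set (ℝ × ℝ), MeasurableSet Γ ∧ π Γ = 1 ∧
    ∀ x ym yp x' y' : ℝ, (x, ym) ∈ Γ → (x, yp) ∈ Γ → (x', y') ∈ Γ →
      x < x' → ym < yp → y' ∉ Set.Ioo ym yp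

/-- The set `A` of points `x` with `π((-∞,x) × (x,∞)) = 0`. -/
def jumpSet (π : Measure (ℝ × ℝ)) : Set ℝ := {x | π (Set.Iio x ×ˢ Set.Ioi x) = 0}

/-- The set `A⁻` of points of `A` isolated on the right in `A`. -/
def jumpSetMinus (π : Measure (ℝ × ℝ)) : Set ℝ :=
  {x ∈ jumpSet π | ∃ ε > 0, Set.Ioo x (x + ε) ∩ jumpSet π = ∅}

/-- Normalised fiber measure `π_x`. -/
def fiberMeasure (π : Measure (ℝ × ℝ)) (x : ℝ) : Measure ℝ :=
  (π.fst {x})⁻¹ • Measure.snd (π.restrict ({x} ×ˢ Set.univ))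

/-- The reduced support `spt* π`. -/
def sptStar (π : Measure (ℝ × ℝ)) : Set (ℝ × ℝ) :=
  (mSupport π \ (jumpSetMinus π ×ˢ (Set.univ : Set ℝ))) ∪
    ⋃ x ∈ {x : ℝ | 0 < π.fst {x}}, {x} ×ˢ mSupport (fiberMeasure π x)


theorem tendsto_toReal_measure_Iic_atBot (ν : Measure ℝ) [IsFiniteMeasure ν] :
    Tendsto (fun x => (ν (Iic x)).toReal) atBot (nhds 0) := by
  have h := tendsto_measure_iInter_atBot (μ := ν) (s := Iic)
    (fun _ => measurableSet_Iic.nullMeasurableSet)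
    (fun _ _ hij => Iic_subset_Iic.2 hij) ⟨0, measure_ne_top _ _⟩
  have hempty : ⋂ x : ℝ, Iic x = ∅ := by
    simpa using (iInter_Iic_eq_empty_iff (f := (id : ℝ → ℝ))).2 (by simp [not_bddBelow_univ])
  rw [hempty, measure_empty] at h
  exact (ENNReal.tendsto_toReal ENNReal.zero_ne_top).comp h

theorem tendsto_toReal_measure_Iic_atTop (ν : Measure ℝ) [IsFiniteMeasure ν] :
    Tendsto (fun x => (ν (Iic x)).toReal) atTop (nhds (ν univ).toReal) :=
  (ENNReal.tendsto_toReal (measure_ne_top ν univ)).comp (tendsto_measure_Iic_atTop ν)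

theorem monotone_toReal_measure_Iic (ν : Measure ℝ) [IsFiniteMeasure ν] :
    Monotone fun x => (ν (Iic x)).toReal := fun _ _ h =>
  ENNReal.toReal_mono (measure_ne_top _ _) (measure_mono (Iic_subset_Iic.2 h))

theorem bddBelow_quantile_set (ν : Measure ℝ) [IsFiniteMeasure ν] {t : ℝ} (ht : 0 < t) :
    BddBelow {x : ℝ | t ≤ (ν (Iic x)).toReal} := by
  obtain ⟨y, hy⟩ := ((tendsto_toReal_measure_Iic_atBot ν).eventually (gt_mem_nhds ht)).exists
  refine ⟨y, fun x hx => ?_⟩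
  by_contra! h
  exact (hx.trans (monotone_toReal_measure_Iic ν h.le)).not_gt hy

theorem nonempty_quantile_set (ν : Measure ℝ) [IsFiniteMeasure ν] {t : ℝ}
    (ht : t < (ν univ).toReal) : {x : ℝ | t ≤ (ν (Iic x)).toReal}.Nonempty := by
  obtain ⟨y, hy⟩ := ((tendsto_toReal_measure_Iic_atTop ν).eventually (lt_mem_nhds ht)).exists
  exact ⟨y, hy.le⟩

theorem quantile_le_iff (ν : Measure ℝ) [IsFiniteMeasure ν] {t : ℝ}
    (ht : t ∈ Ioo 0 (ν univ).toReal) (x : ℝ) :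
    quantile ν t ≤ x ↔ t ≤ (ν (Iic x)).toReal := by
  refine ⟨fun h => ?_, fun h => csInf_le (bddBelow_quantile_set ν ht.1) h⟩
  have hlim : Tendsto (fun y => (ν (Iic y)).toReal) (nhdsWithin x (Ioi x))
      (nhds (ν (Iic x)).toReal) := by
    refine (ENNReal.tendsto_toReal (measure_ne_top ν _)).comp ?_
    have := tendsto_measure_biInter_gt (μ := ν) (s := Iic) (a := x)
      (fun _ _ => measurableSet_Iic.nullMeasurableSet)
      (fun _ _ _ hij => Iic_subset_Iic.2 hij) ⟨x + 1, by simp, measure_ne_top _ _⟩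
    have hI : ⋂ r > x, Iic r = Iic x := by
      ext y
      simpa using forall_gt_imp_ge_iff_le_of_dense (a₁ := y) (a₂ := x)
    rwa [hI] at this
  refine ge_of_tendsto hlim ?_
  filter_upwards [self_mem_nhdsWithin] with y hy
  obtain ⟨z, hz, hzy⟩ := exists_lt_of_csInf_lt (nonempty_quantile_set ν ht.2)
    (lt_of_le_of_lt h hy)
  exact le_trans hz (monotone_toReal_measure_Iic ν hzy.le)

theorem monotoneOn_quantile (ν : Measure ℝ) [IsFiniteMeasure ν] :
    MonotoneOn (quantile ν) (Ioo 0 (ν univ).toReal) := fun _ hs _ ht hst =>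
  csInf_le_csInf (bddBelow_quantile_set ν hs.1) (nonempty_quantile_set ν ht.2)
    fun _ hx => hst.trans hx

theorem aemeasurable_quantile (ν : Measure ℝ) [IsFiniteMeasure ν] :
    AEMeasurable (quantile ν) (volume.restrict (Ioc 0 (ν univ).toReal)) := by
  rw [← restrict_Ioo_eq_restrict_Ioc]
  exact aemeasurable_restrict_of_monotoneOn measurableSet_Ioo (monotoneOn_quantile ν)

theorem ae_mem_Ioo_restrict_Ioc (a b : ℝ) : ∀ᵐ t ∂volume.restrict (Ioc a b), t ∈ Ioo a b := by
  rw [← restrict_Ioo_eq_restrict_Ioc]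
  exact ae_restrict_mem measurableSet_Ioo

theorem map_quantile (ν : Measure ℝ) [IsFiniteMeasure ν] :
    Measure.map (quantile ν) (volume.restrict (Ioc 0 (ν univ).toReal)) = ν := by
  refine Measure.ext_of_Iic _ _ fun x => ?_
  rw [Measure.map_apply_of_aemeasurable (aemeasurable_quantile ν) measurableSet_Iic]
  have hae : quantile ν ⁻¹' Iic x =ᵐ[volume.restrict (Ioc 0 (ν univ).toReal)]
      Iic (ν (Iic x)).toReal := by
    filter_upwards [ae_mem_Ioo_restrict_Ioc 0 (ν univ).toReal] with t ht
    exact propext (quantile_le_iff ν ht x)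
  rw [measure_congr hae, Measure.restrict_apply measurableSet_Iic, inter_comm,
    Ioc_inter_Iic, min_eq_right
      (ENNReal.toReal_mono (measure_ne_top _ _) (measure_mono (subset_univ _))),
    Real.volume_Ioc, sub_zero, ENNReal.ofReal_toReal (measure_ne_top _ _)]

theorem LinGrowth.integrable {φ : ℝ → ℝ} (hφ : LinGrowth φ) (hm : Measurable φ) {μ : Measure ℝ}
    (hμ : MemM μ) : Integrable φ μ := by
  obtain ⟨C, hC⟩ := hφ
  have := hμ.1
  refine Integrable.mono' (((integrable_const (1 : ℝ)).add hμ.2.abs).const_mul C)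
    hm.aestronglyMeasurable (Eventually.of_forall fun x => ?_)
  simpa using hC x

theorem MemM.mono {η ν : Measure ℝ} (hν : MemM ν) (h : η ≤ ν) : MemM η := by
  have := hν.1
  exact ⟨isFiniteMeasure_of_le ν h, hν.2.mono_measure h⟩

theorem leStoP.measure_Ioi_le {μ ν : Measure ℝ} [IsFiniteMeasure μ] [IsFiniteMeasure ν]
    (h : leStoP μ ν) (x : ℝ) : (μ (Ioi x)).toReal ≤ (ν (Ioi x)).toReal := by
  have hnn : ∀ y, 0 ≤ (Ioi x).indicator (fun _ => (1 : ℝ)) y := fun y =>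
    indicator_nonneg (fun _ _ => zero_le_one) y
  have := h ((Ioi x).indicator fun _ => 1) ⟨1, fun y => ?_⟩ (fun a b hab => ?_) hnn
  · simpa [integral_indicator_one measurableSet_Ioi, Measure.real] using this
  · rw [abs_of_nonneg (hnn y)]
    refine (indicator_le_self' (fun _ _ => zero_le_one) y).trans ?_
    linarith [abs_nonneg y]
  · by_cases ha : x < a
    · simp [indicator, ha, ha.trans_le hab]
    · simpa [indicator, ha] using hnn b

theorem leStoP.measure_univ_le {μ ν : Measure ℝ} [IsFiniteMeasure μ] [IsFiniteMeasure ν]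
    (h : leStoP μ ν) : μ univ ≤ ν univ := by
  have := h (fun _ => 1) ⟨1, fun y => by simp⟩ monotone_const (fun _ => zero_le_one)
  simp only [integral_const, Measure.real, smul_eq_mul, mul_one] at this
  exact (ENNReal.toReal_le_toReal (measure_ne_top _ _) (measure_ne_top _ _)).1 this

theorem leStoP.quantile_le {μ ν : Measure ℝ} [IsFiniteMeasure μ] [IsFiniteMeasure ν]
    (h : leStoP μ ν) {t : ℝ} (ht : t ∈ Ioo 0 (μ univ).toReal) :
    quantile μ t ≤ quantile ν (t + ((ν univ).toReal - (μ univ).toReal)) := by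
  refine csInf_le_csInf (bddBelow_quantile_set μ ht.1)
    (nonempty_quantile_set ν (by linarith [ht.2])) fun x hx => ?_
  have hsplit (ρ : Measure ℝ) [IsFiniteMeasure ρ] :
      (ρ (Iic x)).toReal + (ρ (Ioi x)).toReal = (ρ univ).toReal := by
    simpa [Measure.real] using
      measureReal_add_measureReal_compl (μ := ρ) (measurableSet_Iic (a := x))
  have hx' : t + ((ν univ).toReal - (μ univ).toReal) ≤ (ν (Iic x)).toReal := hx
  show t ≤ (μ (Iic x)).toReal
  linarith [hsplit μ, hsplit ν, h.measure_Ioi_le x]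

/-- The rightmost submeasure of `ν` with mass `m`. -/
abbrev rightmost (ν : Measure ℝ) (m : ℝ) : Measure ℝ :=
  Measure.map (quantile ν) (volume.restrict (Ioc ((ν univ).toReal - m) (ν univ).toReal))

theorem Ioc_sub_subset {n m : ℝ} (hm : m ≤ n) : Ioc (n - m) n ⊆ Ioc 0 n :=
  Ioc_subset_Ioc_left (sub_nonneg.2 hm)

theorem rightmost_le (ν : Measure ℝ) [IsFiniteMeasure ν] {m : ℝ} (hm : m ≤ (ν univ).toReal) :
    rightmost ν m ≤ ν := by
  conv_rhs => rw [← map_quantile ν]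
  exact Measure.map_mono_of_aemeasurable
    (Measure.restrict_mono (Ioc_sub_subset hm) le_rfl) (aemeasurable_quantile ν)

theorem leStoP.leSto_rightmost {μ ν : Measure ℝ} (hμ : MemM μ) (hν : MemM ν)
    (hmass : μ univ ≤ ν univ) (h : leStoP μ ν) : leSto μ (rightmost ν (μ univ).toReal) := by
  intro φ hφ hmono
  have := hμ.1
  have := hν.1
  have hm : (μ univ).toReal ≤ (ν univ).toReal := ENNReal.toReal_mono (measure_ne_top _ _) hmass
  set m := (μ univ).toReal
  set n := (ν univ).toReal
  have hqν : AEMeasurable (quantile ν) (volume.restrict (Ioc (n - m) n)) :=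
    (aemeasurable_quantile ν).mono_measure (Measure.restrict_mono (Ioc_sub_subset hm) le_rfl)
  have hiμ := hφ.integrable hmono.measurable hμ
  have hiη := hφ.integrable hmono.measurable (hν.mono (rightmost_le ν hm))
  have hemb : MeasurableEmbedding fun t : ℝ => t + (n - m) :=
    (MeasurableEquiv.addRight (n - m)).measurableEmbedding
  have hmp : MeasurePreserving (fun t : ℝ => t + (n - m)) (volume.restrict (Ioc 0 m))
      (volume.restrict (Ioc (n - m) n)) := by
    have := (measurePreserving_add_right (volume : Measure ℝ) (n - m)).restrict_preimage_emb hemb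
      (Ioc (n - m) n)
    simpa using this
  rw [integral_map hqν hmono.measurable.aestronglyMeasurable, ← hmp.integral_comp hemb]
  have hiη' := (hmp.integrable_comp_emb hemb).2
    ((integrable_map_measure hmono.measurable.aestronglyMeasurable hqν).1 hiη)
  rw [← map_quantile μ] at hiμ ⊢
  rw [integral_map (aemeasurable_quantile μ) hmono.measurable.aestronglyMeasurable]
  refine integral_mono_ae ((integrable_map_measure hmono.measurable.aestronglyMeasurable
    (aemeasurable_quantile μ)).1 hiμ) hiη' ?_
  filter_upwards [ae_mem_Ioo_restrict_Ioc 0 m] with t ht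
  exact hmono (h.quantile_le ht)

/-- decomposition of the order `≤_{sto,+}`, and the rightmost measure of mass
`μ(ℝ)` smaller than `ν` serves as intermediate measure. -/
theorem leStoP_iff_decomposition (μ ν : Measure ℝ) (hμ : MemM μ) (hν : MemM ν) :
    (leStoP μ ν ↔ ∃ η : Measure ℝ, MemM η ∧ leSto μ η ∧ η ≤ ν) ∧
    (μ Set.univ ≤ ν Set.univ → leStoP μ ν →
      leSto μ (Measure.map (quantile ν) (volume.restrict
        (Set.Ioc ((ν Set.univ).toReal - (μ Set.univ).toReal) (ν Set.univ).toReal))) ∧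
      Measure.map (quantile ν) (volume.restrict
        (Set.Ioc ((ν Set.univ).toReal - (μ Set.univ).toReal) (ν Set.univ).toReal)) ≤ ν) := by
  have := hμ.1
  have := hν.1
  have key : μ univ ≤ ν univ → leStoP μ ν →
      leSto μ (rightmost ν (μ univ).toReal) ∧ rightmost ν (μ univ).toReal ≤ ν :=
    fun hmass h => ⟨h.leSto_rightmost hμ hν hmass,
      rightmost_le ν (ENNReal.toReal_mono (measure_ne_top _ _) hmass)⟩
  refine ⟨⟨fun h => ?_, ?_⟩, key⟩
  · obtain ⟨hsto, hle⟩ := key h.measure_univ_le h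
    exact ⟨_, hν.mono hle, hsto, hle⟩
  · rintro ⟨η, -, hsto, hle⟩ φ hφ hmono hnn
    exact (hsto φ hφ hmono).trans (integral_mono_measure hle (Eventually.of_forall hnn)
      (hφ.integrable hmono.measurable hν))

end
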